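/- arXiv:2310.11556 — 5 statements merged into one kernel-verified Lean document; each statement's English description precedes it below -/
import Mathlib

section
/- Let X be a locally compact Hausdorff space, let (μ_n) be a sequence of Borel probability measures on X, and let μ be a Radon Borel probability measure on X. Then ∫ f dμ_n → ∫ f dμ holds for every continuous compactly supported function f : X → ℝ if and only if ∫ f dμ_n → ∫ f dμ holds for every bounded continuous function f : X → ℝ. (In other words, the vague (wide) and narrow (weak) topologies coincide on probability measures on a locally compact Hausdorff space.) -/
open MeasureTheory Filter

/-- On a locally compact Hausdorff space, the vague (wide) and narrow (weak)
topologies coincide on probability measures: a sequence of Borel probability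
measures converges against all continuous compactly supported functions iff
it converges against all bounded continuous functions. -/
theorem vague_iff_narrow_of_probability
    {X : Type*} [TopologicalSpace X] [T2Space X] [LocallyCompactSpace X]
    [MeasurableSpace X] [BorelSpace X]
    (μn : ℕ → Measure X) (μ : Measure X)
    [∀ n, IsProbabilityMeasure (μn n)] [IsProbabilityMeasure μ] [μ.Regular] :
    (∀ f : X → ℝ, Continuous f → HasCompactSupport f →
        Tendsto (fun n => ∫ x, f x ∂(μn n)) atTop (nhds (∫ x, f x ∂μ))) ↔
    (∀ f : X → ℝ, Continuous f → (∃ C : ℝ, ∀ x, |f x| ≤ C) →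
        Tendsto (fun n => ∫ x, f x ∂(μn n)) atTop (nhds (∫ x, f x ∂μ))) := by
  constructor
  · rintro h f hf ⟨C, hC⟩
    have hint : ∀ (u : X → ℝ) (B : ℝ) (ν : Measure X) [IsProbabilityMeasure ν], Continuous u →
        (∀ x, |u x| ≤ B) → Integrable u ν := by
      intro u B ν _ hu hB
      exact Integrable.of_bound hu.measurable.aestronglyMeasurable B
        (Eventually.of_forall fun x => by simpa using hB x)
    have hC' : ∀ x, |f x| ≤ |C| := fun x => (hC x).trans (le_abs_self C)
    have hC0 : 0 ≤ |C| := abs_nonneg C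
    generalize |C| = D at hC' hC0
    rw [Metric.tendsto_atTop']
    intro ε hε
    obtain ⟨δ, hδ, hδε⟩ : ∃ δ : ℝ, 0 < δ ∧ 2 * D * δ < ε := by
      refine ⟨ε / (2 * D + 1), by positivity, ?_⟩
      rw [← mul_div_assoc, div_lt_iff₀ (by positivity)]
      nlinarith
    obtain ⟨K, -, hK, hKμ⟩ : ∃ K ⊆ Set.univ, IsCompact K ∧ ENNReal.ofReal (1 - δ) < μ K := by
      refine isOpen_univ.exists_lt_isCompact ?_
      rw [measure_univ, ENNReal.ofReal_lt_one]
      linarith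
    obtain ⟨g, hg1, -, hgc, hg01⟩ :=
      exists_continuous_one_zero_of_isCompact hK isClosed_empty (Set.disjoint_empty K)
    have hgb : ∀ x, |g x| ≤ 1 := fun x => abs_le.2 ⟨by linarith [(hg01 x).1], (hg01 x).2⟩
    have hgμ : 1 - δ ≤ ∫ x, g x ∂μ := by
      have h1 : μ.real K ≤ ∫ x, g x ∂μ := by
        rw [← integral_indicator_one hK.measurableSet]
        refine integral_mono ((integrable_const (1 : ℝ)).indicator hK.measurableSet)
          (hint g 1 μ g.continuous hgb) ?_
        intro x
        by_cases hx : x ∈ K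
        · simp [hx, hg1 hx]
        · simp [hx, (hg01 x).1]
      have h2 : 1 - δ ≤ μ.real K :=
        (ENNReal.ofReal_le_iff_le_toReal (measure_ne_top _ _)).1 hKμ.le
      exact h2.trans h1
    have key : ∀ (ν : Measure X) [IsProbabilityMeasure ν],
        |∫ x, f x ∂ν - ∫ x, f x * g x ∂ν| ≤ D * (1 - ∫ x, g x ∂ν) := by
      intro ν _
      have hfi := hint f D ν hf hC'
      have hgi := hint g 1 ν g.continuous hgb
      have hfgi : Integrable (fun x => f x * g x) ν :=
        hint _ (D * 1) ν (hf.mul g.continuous) (fun x => by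
          rw [abs_mul]; exact mul_le_mul (hC' x) (hgb x) (abs_nonneg _) hC0)
      have e : D * (1 - ∫ x, g x ∂ν) = ∫ x, D * (1 - g x) ∂ν := by
        rw [integral_const_mul, integral_sub (integrable_const _) hgi]
        simp
      rw [← integral_sub hfi hfgi, e]
      refine abs_integral_le_integral_abs.trans ?_
      refine integral_mono (hfi.sub hfgi).abs (((integrable_const _).sub hgi).const_mul D) ?_
      intro x
      have : f x - f x * g x = f x * (1 - g x) := by ring
      simp only [this, abs_mul]
      rw [abs_of_nonneg (sub_nonneg.2 (hg01 x).2)]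
      exact mul_le_mul_of_nonneg_right (hC' x) (sub_nonneg.2 (hg01 x).2)
    have t1 := h g g.continuous hgc
    have t2 := h (fun x => f x * g x) (hf.mul g.continuous) (hgc.mul_left)
    have t3 : Tendsto (fun n => D * (1 - ∫ x, g x ∂(μn n)) +
        |∫ x, f x * g x ∂(μn n) - ∫ x, f x * g x ∂μ| + D * (1 - ∫ x, g x ∂μ)) atTop
        (nhds (D * (1 - ∫ x, g x ∂μ) +
        |∫ x, f x * g x ∂μ - ∫ x, f x * g x ∂μ| + D * (1 - ∫ x, g x ∂μ))) :=
      (((t1.const_sub 1).const_mul D).add (t2.sub_const _).abs).add_const _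
    have hlt : D * (1 - ∫ x, g x ∂μ) +
        |∫ x, f x * g x ∂μ - ∫ x, f x * g x ∂μ| + D * (1 - ∫ x, g x ∂μ) < ε := by
      rw [sub_self, abs_zero]
      nlinarith
    obtain ⟨N, hN⟩ := eventually_atTop.1 (t3.eventually_lt_const hlt)
    refine ⟨N, fun n hn => ?_⟩
    have b := hN n hn.le
    rw [Real.dist_eq]
    have k1 := abs_le.1 (key (μn n))
    have k2 := abs_le.1 (key μ)
    have k3 := le_abs_self (∫ x, f x * g x ∂(μn n) - ∫ x, f x * g x ∂μ)
    have k4 := neg_abs_le (∫ x, f x * g x ∂(μn n) - ∫ x, f x * g x ∂μ)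
    rw [abs_lt]
    constructor <;> linarith [k1.1, k1.2, k2.1, k2.2]
  · intro h f hf hfc
    refine h f hf ?_
    obtain ⟨C, hC⟩ := hfc.exists_bound_of_continuous hf
    exact ⟨C, fun x => by simpa using hC x⟩
end

section
/- Let X be a second countable, locally compact metric space and let (μ_n) be a sequence of Radon measures on X such that sup_n μ_n(K) < ∞ for every compact set K ⊆ X. Then there exists a subsequence (μ_{n_j}) and a Radon measure μ on X such that ∫ f dμ_{n_j} → ∫ f dμ for every continuous compactly supported function f : X → ℝ. (A family of Radon measures that is uniformly bounded on compact sets is vaguely precompact.) -/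
open MeasureTheory Filter

lemma vague_aux_dense {X : Type*} [MetricSpace X] [SecondCountableTopology X]
    [LocallyCompactSpace X] (K : Set X) (hK : IsCompact K) :
    ∃ d : ℕ → C(X, ℝ), (∀ k x, x ∉ K → d k x = 0) ∧
      ∀ f : C(X, ℝ), (∀ x, x ∉ K → f x = 0) → ∀ ε > 0, ∃ k, ∀ x, |f x - d k x| ≤ ε := by
  let S : Set C(X, ℝ) := {f | ∀ x, x ∉ K → f x = 0}
  haveI : Nonempty S := ⟨⟨0, fun x _ => rfl⟩⟩
  refine ⟨fun k => (TopologicalSpace.denseSeq S k : C(X, ℝ)),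
    fun k x hx => (TopologicalSpace.denseSeq S k).2 x hx, ?_⟩
  intro f hf ε hε
  let U : Set S := {g | Set.MapsTo (f - (g : C(X, ℝ))) K (Metric.ball 0 ε)}
  have hU : IsOpen U := by
    have h1 : IsOpen {h : C(X, ℝ) | Set.MapsTo h K (Metric.ball (0 : ℝ) ε)} :=
      ContinuousMap.isOpen_setOf_mapsTo hK Metric.isOpen_ball
    have h2 : Continuous (fun g : S => f - (g : C(X, ℝ))) := by fun_prop
    exact h1.preimage h2
  have hne : U.Nonempty := ⟨⟨f, hf⟩, fun x _ => by simp [hε]⟩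
  obtain ⟨k, hk⟩ := (TopologicalSpace.denseRange_denseSeq S).exists_mem_open hU hne
  refine ⟨k, fun x => ?_⟩
  by_cases hx : x ∈ K
  · have := hk hx
    simp only [Metric.mem_ball, dist_zero_right, Real.norm_eq_abs] at this
    exact this.le
  · rw [hf x hx, (TopologicalSpace.denseSeq S k).2 x hx]
    simpa using hε.le

lemma vague_aux_bound {X : Type*} [MetricSpace X] 
    [MeasurableSpace X] [BorelSpace X]
    (μn : ℕ → Measure X)
    (hbdd : ∀ K : Set X, IsCompact K → (⨆ n, μn n K) < ⊤) (K : Set X) (hK : IsCompact K) :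
    ∃ C : ℝ, 0 ≤ C ∧ ∀ n (f : X → ℝ) (ε : ℝ), 0 ≤ ε → (∀ x, x ∉ K → f x = 0) →
      (∀ x, |f x| ≤ ε) → |∫ x, f x ∂(μn n)| ≤ ε * C := by
  refine ⟨(⨆ n, μn n K).toReal, ENNReal.toReal_nonneg, ?_⟩
  intro n f ε hε hf hb
  rw [← setIntegral_eq_integral_of_forall_compl_eq_zero hf]
  have hle : μn n K ≤ ⨆ n, μn n K := le_iSup (fun n => μn n K) n
  have := norm_setIntegral_le_of_norm_le_const (μ := μn n) (s := K) (f := f) (C := ε)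
    (hle.trans_lt (hbdd K hK)) (fun x _ => hb x)
  refine this.trans (mul_le_mul_of_nonneg_left ?_ hε)
  exact ENNReal.toReal_mono (hbdd K hK).ne hle

/-- A sequence of Radon measures on a second countable, locally compact metric
space that is uniformly bounded on compact sets has a vaguely convergent
subsequence with a Radon limit. -/
theorem exists_vague_convergent_subsequence
    {X : Type*} [MetricSpace X] [SecondCountableTopology X] [LocallyCompactSpace X]
    [MeasurableSpace X] [BorelSpace X]
    (μn : ℕ → Measure X) [∀ n, (μn n).Regular]
    (hbdd : ∀ K : Set X, IsCompact K → (⨆ n, μn n K) < ⊤) :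
    ∃ φ : ℕ → ℕ, StrictMono φ ∧ ∃ μ : Measure X, μ.Regular ∧
      ∀ f : X → ℝ, Continuous f → HasCompactSupport f →
        Tendsto (fun j => ∫ x, f x ∂(μn (φ j))) atTop (nhds (∫ x, f x ∂μ)) := by
  let E : CompactExhaustion X := default
  choose d hd0 hd using fun m => vague_aux_dense (E m) (E.isCompact m)
  choose C hC0 hC using fun m => vague_aux_bound μn hbdd (E m) (E.isCompact m)
  have hint : ∀ n (f : X → ℝ), Continuous f → HasCompactSupport f → Integrable f (μn n) :=
    fun n f hf hs => hf.integrable_of_hasCompactSupport hs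
  have hdc : ∀ m k, HasCompactSupport (d m k) := fun m k =>
    HasCompactSupport.intro (E.isCompact m) (fun x hx => hd0 m k x hx)
  -- extraction
  have hB : ∀ p : ℕ × ℕ, ∃ B : ℝ, ∀ n, |∫ x, d p.1 p.2 x ∂(μn n)| ≤ B := by
    intro p
    obtain ⟨B, hB⟩ := (d p.1 p.2).continuous.bounded_above_of_compact_support (hdc p.1 p.2)
    exact ⟨max B 0 * C p.1, fun n => hC p.1 n _ _ (le_max_right _ _) (hd0 p.1 p.2)
      (fun x => (hB x).trans (le_max_left _ _))⟩
  choose B hB using hB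
  have hcomp : IsCompact (Set.univ.pi fun p : ℕ × ℕ => Set.Icc (-B p) (B p)) :=
    isCompact_univ_pi fun p => isCompact_Icc
  obtain ⟨a, -, φ, hφ, ha⟩ := hcomp.tendsto_subseq
    (x := fun n (p : ℕ × ℕ) => ∫ x, d p.1 p.2 x ∂(μn n))
    (fun n p _ => abs_le.1 (hB p n))
  rw [tendsto_pi_nhds] at ha
  have hlim : ∀ f : X → ℝ, Continuous f → HasCompactSupport f →
      ∃ l, Tendsto (fun j => ∫ x, f x ∂(μn (φ j))) atTop (nhds l) := by
    intro f hf hs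
    apply cauchySeq_tendsto_of_complete
    obtain ⟨m, hm⟩ := E.exists_superset_of_isCompact hs
    have hf0 : ∀ x, x ∉ E m → f x = 0 := fun x hx => image_eq_zero_of_notMem_tsupport
      (fun h => hx (hm h))
    rw [Metric.cauchySeq_iff']
    intro ε hε
    have hC1 : 0 < C m + 1 := by linarith [hC0 m]
    obtain ⟨k, hk⟩ := hd m ⟨f, hf⟩ hf0 (ε / (4 * (C m + 1))) (by positivity)
    simp only [ContinuousMap.coe_mk] at hk
    have key : ∀ n, |∫ x, f x ∂(μn n) - ∫ x, d m k x ∂(μn n)| ≤ ε / 4 := by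
      intro n
      rw [← integral_sub (hint n f hf hs) (hint n _ (d m k).continuous (hdc m k))]
      refine (hC m n (fun x => f x - d m k x) _ (by positivity)
        (fun x hx => by simp [hf0 x hx, hd0 m k x hx]) hk).trans ?_
      rw [div_mul_eq_mul_div, div_le_div_iff₀ (by positivity) (by norm_num)]
      nlinarith
    obtain ⟨N, hN⟩ := Metric.cauchySeq_iff'.1 (ha (m, k)).cauchySeq (ε / 2) (by positivity)
    refine ⟨N, fun n hn => ?_⟩
    have h1 := hN n hn
    have h2 := key (φ n)
    have h3 := key (φ N)
    simp only [Real.dist_eq, Function.comp] at h1 ⊢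
    rw [abs_lt] at h1 ⊢
    rw [abs_le] at h2 h3
    constructor <;> linarith [h1.1, h1.2, h2.1, h2.2, h3.1, h3.2]
  choose! L hL using hlim
  let Λ₀ : CompactlySupportedContinuousMap X ℝ →ₗ[ℝ] ℝ :=
    { toFun := fun f => L f
      map_add' := fun f g => by
        refine tendsto_nhds_unique (hL _ (f + g).continuous (f + g).hasCompactSupport) ?_
        refine ((hL _ f.continuous f.hasCompactSupport).add
          (hL _ g.continuous g.hasCompactSupport)).congr fun j => ?_
        rw [← integral_add (hint _ _ f.continuous f.hasCompactSupport)
          (hint _ _ g.continuous g.hasCompactSupport)]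
        rfl
      map_smul' := fun c f => by
        refine tendsto_nhds_unique (hL _ (c • f).continuous (c • f).hasCompactSupport) ?_
        refine ((hL _ f.continuous f.hasCompactSupport).const_mul c).congr fun j => ?_
        rw [← integral_const_mul]
        rfl }
  let Λ : CompactlySupportedContinuousMap X ℝ →ₚ[ℝ] ℝ := PositiveLinearMap.mk₀ Λ₀ (by
    intro f hf
    refine ge_of_tendsto' (hL _ f.continuous f.hasCompactSupport) fun j => ?_
    exact integral_nonneg hf)
  refine ⟨φ, hφ, RealRMK.rieszMeasure Λ, inferInstance, fun f hf hs => ?_⟩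
  have h := RealRMK.integral_rieszMeasure Λ ⟨⟨f, hf⟩, hs⟩
  have h' : ∫ x, f x ∂(RealRMK.rieszMeasure Λ) = L f := h
  rw [h']
  exact hL f hf hs
end

section
/- Let X be a Hausdorff topological space equipped with a continuous action of the multiplicative group of positive real numbers, written (t, x) ↦ t • x. Let d > 0 be a real number and let μ be a Borel measure on X that is locally finite (every point has an open neighborhood of finite measure) and homogeneous of degree d, meaning μ(t • B) = t^d · μ(B) for every Borel set B ⊆ X and every t > 0. If A ⊆ X is a compact set such that A ∩ (t • A) = ∅ for every real t > 1, then μ(A) = 0. -/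
open MeasureTheory Filter

/-- If a locally finite Borel measure `μ` on a Hausdorff space with a continuous
action of the positive reals is homogeneous of degree `d > 0`, then any compact
set disjoint from all of its dilates by factors `t > 1` is `μ`-null. -/
theorem measure_eq_zero_of_disjoint_dilates
    {X : Type*} [TopologicalSpace X] [T2Space X]
    [MeasurableSpace X] [BorelSpace X]
    (σ : ℝ → X → X)
    (hcont : Continuous (fun p : {t : ℝ // 0 < t} × X => σ p.1 p.2))
    (hone : ∀ x, σ 1 x = x)
    (hmul : ∀ s t : ℝ, 0 < s → 0 < t → ∀ x, σ (s * t) x = σ s (σ t x))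
    (d : ℝ) (hd : 0 < d)
    (μ : Measure X) [IsLocallyFiniteMeasure μ]
    (hhom : ∀ B : Set X, MeasurableSet B → ∀ t : ℝ, 0 < t →
        μ (σ t '' B) = ENNReal.ofReal (t ^ d) * μ B)
    (A : Set X) (hA : IsCompact A)
    (hdisj : ∀ t : ℝ, 1 < t → A ∩ (σ t '' A) = ∅) :
    μ A = 0 := by
  have key : ∀ s t : ℝ, 0 < s → s < t → Disjoint (σ s '' A) (σ t '' A) := by
    intro s t hs hst
    rw [Set.disjoint_left]
    rintro _ ⟨a, ha, rfl⟩ ⟨b, hb, hab⟩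
    have h1 : 1 < t / s := (one_lt_div hs).2 hst
    have ht : 0 < t := hs.trans hst
    have h2 : σ (t / s) b = a := by
      have e : t / s = s⁻¹ * t := by field_simp
      rw [e, hmul _ _ (inv_pos.2 hs) ht, hab, ← hmul _ _ (inv_pos.2 hs) hs,
        inv_mul_cancel₀ hs.ne', hone]
    have h3 : a ∈ A ∩ (σ (t / s) '' A) := ⟨ha, b, hb, h2⟩
    rw [hdisj _ h1] at h3
    exact h3
  have hI : IsCompact {p : {t : ℝ // 0 < t} | (p : ℝ) ∈ Set.Icc (1 : ℝ) 2} := by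
    rw [Subtype.isCompact_iff]
    convert (isCompact_Icc : IsCompact (Set.Icc (1 : ℝ) 2)) using 1
    ext x
    constructor
    · rintro ⟨y, hy, rfl⟩
      exact hy
    · intro hx
      exact ⟨⟨x, lt_of_lt_of_le one_pos hx.1⟩, hx, rfl⟩
  have hK := (hI.prod hA).image hcont
  have hfin := hK.measure_lt_top (μ := μ)
  let t : ℕ → ℝ := fun n => 1 + 1 / ((n : ℝ) + 1)
  have ht1 : ∀ n, 1 ≤ t n := fun n => by
    have : (0 : ℝ) ≤ 1 / ((n : ℝ) + 1) := by positivity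
    simp only [t]; linarith
  have ht0 : ∀ n, 0 < t n := fun n => one_pos.trans_le (ht1 n)
  have ht2 : ∀ n, t n ≤ 2 := fun n => by
    have : 1 / ((n : ℝ) + 1) ≤ 1 := by
      rw [div_le_one (by positivity)]
      linarith [(Nat.cast_nonneg n : (0 : ℝ) ≤ n)]
    simp only [t]; linarith
  have hinj : ∀ m n, m < n → t n < t m := fun m n h => by
    have := Nat.one_div_lt_one_div (α := ℝ) h
    simp only [t]; linarith
  have hpd : Pairwise (Function.onFun Disjoint fun n => σ (t n) '' A) := by
    intro m n hmn
    rcases lt_or_gt_of_ne hmn with h | h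
    · exact (key _ _ (ht0 n) (hinj _ _ h)).symm
    · exact key _ _ (ht0 m) (hinj _ _ h)
  have hms : ∀ n, MeasurableSet (σ (t n) '' A) := by
    intro n
    have hc : Continuous (σ (t n)) :=
      hcont.comp (Continuous.prodMk_right (⟨t n, ht0 n⟩ : {t : ℝ // 0 < t}))
    exact (hA.image hc).measurableSet
  have hle : ∀ n, μ A ≤ μ (σ (t n) '' A) := by
    intro n
    rw [hhom A hA.measurableSet _ (ht0 n)]
    refine le_mul_of_one_le_left zero_le ?_
    rw [ENNReal.one_le_ofReal]
    exact Real.one_le_rpow (ht1 n) hd.le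
  by_contra h0
  have hsub : (⋃ n, σ (t n) '' A) ⊆ (fun p : {t : ℝ // 0 < t} × X => σ p.1 p.2) ''
      ({p : {t : ℝ // 0 < t} | (p : ℝ) ∈ Set.Icc (1 : ℝ) 2} ×ˢ A) := by
    refine Set.iUnion_subset fun n => ?_
    rintro _ ⟨a, ha, rfl⟩
    exact ⟨(⟨t n, ht0 n⟩, a), ⟨⟨ht1 n, ht2 n⟩, ha⟩, rfl⟩
  have h1 := (measure_mono hsub).trans_lt hfin
  rw [measure_iUnion hpd hms] at h1
  have h2 : ∑' _ : ℕ, μ A ≤ ∑' n, μ (σ (t n) '' A) := ENNReal.tsum_le_tsum hle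
  rw [ENNReal.tsum_const_eq_top_of_ne_zero h0] at h2
  exact absurd h1 (not_lt.2 h2)
end

section
/- Let n ≥ 1 and let A ⊆ ℝ^n be a Lebesgue-measurable set such that A ∩ (t • A) = ∅ for every real number t > 1, where t • A = {t·x : x ∈ A}. Then A has Lebesgue measure zero. -/
open MeasureTheory
open scoped Pointwise

theorem aux_bounded_dilates (n : ℕ) (B : Set (Fin n → ℝ)) (hB : MeasurableSet B) (R : ℝ)
    (hR : B ⊆ Metric.closedBall 0 R)
    (hdisj : ∀ t : ℝ, 1 < t → B ∩ (t • B) = ∅) : volume B = 0 := by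
  by_contra h
  let t : ℕ → ℝ := fun k => 1 + 1 / ((k : ℝ) + 1)
  have ht1 : ∀ k, 1 < t k := fun k => by
    have : (0 : ℝ) < 1 / ((k : ℝ) + 1) := by positivity
    simp only [t]; linarith
  have ht2 : ∀ k, t k ≤ 2 := fun k => by
    have : 1 / ((k : ℝ) + 1) ≤ 1 := by
      rw [div_le_one (by positivity)]
      have : (0 : ℝ) ≤ k := k.cast_nonneg
      linarith
    simp only [t]; linarith
  have hinj : Function.Injective t := fun a b hab => by
    simp only [t, add_right_inj, one_div, inv_inj, add_left_inj, Nat.cast_inj] at hab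
    exact hab
  have key : ∀ a b : ℝ, 0 < a → a < b → Disjoint (a • B) (b • B) := by
    intro a b ha hab
    rw [Set.disjoint_left]
    rintro _ ⟨x, hx, rfl⟩ ⟨y, hy, hxy⟩
    have hxy' : b • y = a • x := hxy
    have h1 : x ∈ B ∩ ((b / a) • B) := by
      refine ⟨hx, y, hy, ?_⟩
      change (b / a) • y = x
      rw [div_eq_inv_mul, mul_smul, hxy', inv_smul_smul₀ ha.ne']
    rw [hdisj _ ((one_lt_div ha).2 hab)] at h1
    exact h1
  have hpw : Pairwise (Function.onFun Disjoint fun k => t k • B) := by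
    intro i j hij
    have hi := ht1 i
    have hj := ht1 j
    rcases lt_or_gt_of_ne (hinj.ne hij) with hlt | hlt
    · exact key _ _ (by linarith) hlt
    · exact (key _ _ (by linarith) hlt).symm
  have hsub : (⋃ k, t k • B) ⊆ Metric.closedBall 0 (2 * R) := by
    refine Set.iUnion_subset fun k => ?_
    rintro _ ⟨x, hx, rfl⟩
    have hx' := hR hx
    have hk := ht1 k
    rw [mem_closedBall_zero_iff] at hx' ⊢
    change ‖t k • x‖ ≤ _
    rw [norm_smul, Real.norm_of_nonneg (by linarith)]
    exact mul_le_mul (ht2 k) hx' (norm_nonneg _) (by norm_num)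
  have hle : ∀ k, volume B ≤ volume (t k • B) := fun k => by
    have hk := ht1 k
    rw [Measure.addHaar_smul_of_nonneg _ (by linarith)]
    refine le_mul_of_one_le_left (zero_le) ?_
    rw [ENNReal.one_le_ofReal]
    exact one_le_pow₀ hk.le
  have htop : (⊤ : ENNReal) ≤ volume (Metric.closedBall (0 : Fin n → ℝ) (2 * R)) :=
    calc (⊤ : ENNReal) = ∑' _ : ℕ, volume B := (ENNReal.tsum_const_eq_top_of_ne_zero h).symm
      _ ≤ ∑' k : ℕ, volume (t k • B) := ENNReal.tsum_le_tsum hle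
      _ = volume (⋃ k, t k • B) := (measure_iUnion hpw fun k =>
          hB.const_smul_of_ne_zero (by have := ht1 k; linarith)).symm
      _ ≤ _ := measure_mono hsub
  exact absurd htop (not_le.2 measure_closedBall_lt_top)

/-- A Lebesgue-measurable subset of `ℝⁿ` that is disjoint from all of its
dilates `t • A` for `t > 1` has Lebesgue measure zero. -/
theorem volume_eq_zero_of_disjoint_dilates
    (n : ℕ) (hn : 1 ≤ n) (A : Set (Fin n → ℝ))
    (hA : NullMeasurableSet A volume)
    (hdisj : ∀ t : ℝ, 1 < t → A ∩ (t • A) = ∅) :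
    volume A = 0 := by
  obtain ⟨B, hBA, hB, hae⟩ := hA.exists_measurable_subset_ae_eq
  rw [← measure_congr hae, ← Metric.iUnion_inter_closedBall_nat B 0, measure_iUnion_null_iff]
  intro k
  refine aux_bounded_dilates n _ (hB.inter measurableSet_closedBall) k Set.inter_subset_right ?_
  intro t ht
  have hs : B ∩ Metric.closedBall 0 (k : ℝ) ⊆ A := Set.inter_subset_left.trans hBA
  exact Set.subset_eq_empty (Set.inter_subset_inter hs (Set.smul_set_mono hs)) (hdisj t ht)
end

section
/- Let k ≥ 1 be a natural number and let w, ℓ, ℓ' : Fin k → ℝ and real numbers 0 < m ≤ M and N satisfy: m ≤ w i ≤ M for all i, M ≤ N·m, and ℓ i ≥ 0 and ℓ' i ≥ 0 for all i. If ∑_i w i · (ℓ i)² ≤ ∑_i w i · (ℓ' i)², then ∑_i w i · ℓ i ≤ N · √(N·k) · ∑_i w i · ℓ' i. -/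
/-- Quantitative quasi-minimization: if a weight vector `w` has entries between
`m` and `M` with `M ≤ N m`, and the `w`-weighted `ℓ²` energy of the length
vector `ℓ` is at most that of `ℓ'`, then the `w`-weighted length of `ℓ` is at
most `N √(N k)` times that of `ℓ'`. -/
theorem weighted_length_quasi_minimizer
    (k : ℕ) (hk : 1 ≤ k) (w ℓ ℓ' : Fin k → ℝ)
    (m M N : ℝ) (hm : 0 < m) (hmM : m ≤ M)
    (hw : ∀ i, m ≤ w i ∧ w i ≤ M) (hMN : M ≤ N * m)
    (hℓ : ∀ i, 0 ≤ ℓ i) (hℓ' : ∀ i, 0 ≤ ℓ' i)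
    (henergy : ∑ i, w i * ℓ i ^ 2 ≤ ∑ i, w i * ℓ' i ^ 2) :
    ∑ i, w i * ℓ i ≤ N * Real.sqrt (N * k) * ∑ i, w i * ℓ' i := by
  have hN : 1 ≤ N := by
    by_contra h
    push Not at h
    nlinarith
  have hw0 : ∀ i, 0 ≤ w i := fun i => hm.le.trans (hw i).1
  have hk0 : (0 : ℝ) ≤ k := Nat.cast_nonneg k
  have hS' : 0 ≤ ∑ i, w i * ℓ' i :=
    Finset.sum_nonneg fun i _ => mul_nonneg (hw0 i) (hℓ' i)
  have h1 : (∑ i, w i * ℓ i) ^ 2 ≤ k * ∑ i, (w i * ℓ i) ^ 2 := by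
    have := sq_sum_le_card_mul_sum_sq (s := Finset.univ) (f := fun i => w i * ℓ i)
    simpa using this
  have h2 : ∑ i, (w i * ℓ i) ^ 2 ≤ (N * m) * ∑ i, w i * ℓ i ^ 2 := by
    rw [Finset.mul_sum]
    refine Finset.sum_le_sum fun i _ => ?_
    have := mul_le_mul_of_nonneg_right ((hw i).2.trans hMN)
      (mul_nonneg (hw0 i) (sq_nonneg (ℓ i)))
    linarith
  have h3 : m * ∑ i, w i * ℓ' i ^ 2 ≤ ∑ i, (w i * ℓ' i) ^ 2 := by
    rw [Finset.mul_sum]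
    refine Finset.sum_le_sum fun i _ => ?_
    have := mul_le_mul_of_nonneg_right (hw i).1
      (mul_nonneg (hw0 i) (sq_nonneg (ℓ' i)))
    linarith
  have h4 : ∑ i, (w i * ℓ' i) ^ 2 ≤ (∑ i, w i * ℓ' i) ^ 2 :=
    Finset.sum_sq_le_sq_sum_of_nonneg fun i _ => mul_nonneg (hw0 i) (hℓ' i)
  have hNk : 0 ≤ N * k := by positivity
  have h5 : (∑ i, w i * ℓ i) ^ 2 ≤ (N * k) * (∑ i, w i * ℓ' i) ^ 2 := by
    calc (∑ i, w i * ℓ i) ^ 2 ≤ k * ∑ i, (w i * ℓ i) ^ 2 := h1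
      _ ≤ k * ((N * m) * ∑ i, w i * ℓ i ^ 2) := by gcongr
      _ ≤ k * ((N * m) * ∑ i, w i * ℓ' i ^ 2) := by gcongr
      _ = (N * k) * (m * ∑ i, w i * ℓ' i ^ 2) := by ring
      _ ≤ (N * k) * (∑ i, w i * ℓ' i) ^ 2 := by
        gcongr
        exact h3.trans h4
  have h6 : ∑ i, w i * ℓ i ≤ Real.sqrt (N * k) * ∑ i, w i * ℓ' i := by
    refine (pow_le_pow_iff_left₀ (Finset.sum_nonneg fun i _ => mul_nonneg (hw0 i) (hℓ i)) 
      (mul_nonneg (Real.sqrt_nonneg _) hS') two_ne_zero).1 ?_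
    rw [mul_pow, Real.sq_sqrt hNk]
    exact h5
  have h7 : 0 ≤ Real.sqrt (N * k) * ∑ i, w i * ℓ' i := by positivity
  rw [mul_assoc]
  nlinarith
end
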